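/- arXiv:0804.4842 — 2 statements merged into one kernel-verified Lean document; each statement's English description precedes it below -/
import Mathlib

section
/- Let A = (a_{ij}) ∈ ℕ₀^{m×m} and let λ, φ ∈ ℕ₀^m satisfy λ_i + φ_j ≥ a_{ij} for all 1 ≤ i, j ≤ m. Fix k ≥ max_{i,j}{a_{ij}} with k ≥ λ_i and k ≥ φ_j for all i, j, and define Λ ∈ ℕ₀^{km} by Λ_{ih} = 0 for 1 ≤ h ≤ k−λ_i and Λ_{ih} = 1 for k−λ_i < h ≤ k, and Φ ∈ ℕ₀^{km} by Φ_{jl} = 1 for 1 ≤ l ≤ φ_j and Φ_{jl} = 0 for φ_j < l ≤ k. Then Λ_{ih} + Φ_{jl} ≥ (T_{k,a_{ij}})_{hl} for all 1 ≤ i, j ≤ m and 1 ≤ h, l ≤ k; that is, (Λ, Φ) is a covering of the block matrix T_k(A) with Σ Λ_{ih} + Σ Φ_{jl} = Σ λ_i + Σ φ_j. -/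
open scoped Classical

noncomputable section

namespace JacobiBound

/-- the `k×k` lower triangular binary matrix `T_{k,a}` (`0 ≤ a ≤ k`), whose `a` lowest
diagonals (in `1`-based indexing, entries `(h,l)` with `k−a ≤ h−l ≤ k−1`) are filled
with `1`'s and whose remaining entries are `0`; here `h l : Fin k` are `0`-based. -/
def Tka (k a : ℕ) (h l : Fin k) : ℕ :=
  if (l : ℕ) ≤ (h : ℕ) ∧ k - a ≤ (h : ℕ) - (l : ℕ) then 1 else 0

/-- the `km×km` block matrix `T_k(A)` whose `(i,j)` block is `T_{k, a_{ij}}` -/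
def TkA {m : ℕ} (A : Fin m → Fin m → ℕ) (k : ℕ) :
    Fin m × Fin k → Fin m × Fin k → ℕ :=
  fun p q => Tka k (A p.1 q.1) p.2 q.2

/-- the vector `Λ` built from `λ`: `Λ_{ih} = 0` for `1 ≤ h ≤ k−λ_i`, `Λ_{ih} = 1`
for `k−λ_i < h ≤ k` (here `h : Fin k` is `0`-based, representing `h+1`). -/
def bigLambda (k : ℕ) {m : ℕ} (lam : Fin m → ℕ) : Fin m × Fin k → ℕ :=
  fun p => if k - lam p.1 ≤ (p.2 : ℕ) then 1 else 0

/-- the vector `Φ` built from `φ`: `Φ_{jl} = 1` for `1 ≤ l ≤ φ_j`, `Φ_{jl} = 0`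
for `φ_j < l ≤ k` (here `l : Fin k` is `0`-based, representing `l+1`). -/
def bigPhi (k : ℕ) {m : ℕ} (phi : Fin m → ℕ) : Fin m × Fin k → ℕ :=
  fun q => if (q.2 : ℕ) < phi q.1 then 1 else 0

theorem sum_low (k a : ℕ) (ha : a ≤ k) :
    (∑ x : Fin k, if (x : ℕ) < a then 1 else 0) = a := by
  rw [Fin.sum_univ_eq_sum_range (fun x => if x < a then 1 else 0) k, ← Finset.card_filter]
  have : (Finset.range k).filter (fun x => x < a) = Finset.range a := by
    ext x
    simp only [Finset.mem_filter, Finset.mem_range]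
    omega
  rw [this, Finset.card_range]

theorem sum_high (k a : ℕ) (ha : a ≤ k) :
    (∑ x : Fin k, if k - a ≤ (x : ℕ) then 1 else 0) = a := by
  rw [Fin.sum_univ_eq_sum_range (fun x => if k - a ≤ x then 1 else 0) k, ← Finset.card_filter]
  have : (Finset.range k).filter (fun x => k - a ≤ x) = Finset.Ico (k - a) k := by
    ext x
    simp only [Finset.mem_filter, Finset.mem_range, Finset.mem_Ico]
    omega
  rw [this, Nat.card_Ico]
  omega

/-- If `λ_i + φ_j ≥ a_{ij}` for all `i,j` and
`k ≥ max a_{ij}, λ_i, φ_j`, then `(Λ, Φ)` is a covering of the block matrix `T_k(A)`,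
with total sum `Σ Λ_{ih} + Σ Φ_{jl} = Σ λ_i + Σ φ_j`. -/
theorem lambda_phi_cover_TkA {m : ℕ} (A : Fin m → Fin m → ℕ)
    (lam phi : Fin m → ℕ) (hcov : ∀ i j, A i j ≤ lam i + phi j)
    (k : ℕ) (hka : ∀ i j, A i j ≤ k) (hkl : ∀ i, lam i ≤ k) (hkp : ∀ j, phi j ≤ k) :
    (∀ (i j : Fin m) (h l : Fin k),
      Tka k (A i j) h l ≤ bigLambda k lam (i, h) + bigPhi k phi (j, l)) ∧
    (∑ p : Fin m × Fin k, bigLambda k lam p) + (∑ q : Fin m × Fin k, bigPhi k phi q)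
      = (∑ i, lam i) + ∑ j, phi j := by
  refine ⟨fun i j h l => ?_, ?_⟩
  · have h1 := hcov i j
    have h2 := hka i j
    have h3 := hkl i
    have h4 := hkp j
    unfold Tka bigLambda bigPhi
    dsimp only
    split_ifs <;> omega
  · rw [Fintype.sum_prod_type, Fintype.sum_prod_type]
    congr 1
    · exact Finset.sum_congr rfl fun i _ => by
        simpa [bigLambda] using sum_high k (lam i) (hkl i)
    · exact Finset.sum_congr rfl fun j _ => by
        simpa [bigPhi] using sum_low k (phi j) (hkp j)

end JacobiBound
end
end

section
/- Let (𝔖) be the first-order system f_1(X,Ẋ) = 0,…, f_n(X,Ẋ) = 0 with f_1,…,f_n ∈ ℂ[X,Ẋ] polynomials in the n differential unknowns X = X_1,…,X_n and their first derivatives, such that the differential ideal 𝔔 := [f_1,…,f_n] ⊂ ℂ{X} is prime, (𝔖) is quasi-regular at 𝔔 and the standing rank hypothesis holds. Let V_0 ⊂ ℂ^n and V_1 ⊂ ℂ^{2n} be the irreducible affine varieties defined by 𝔔∩ℂ[X] and 𝔔∩ℂ[X,Ẋ] respectively, and let π: V_1 → V_0 be the projection (x,ẋ) ↦ x. Then for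 every regular (smooth) point (x_0, p_0) ∈ V_1 at which π is unramified, there exist ε > 0, a relatively open neighborhood 𝒰 ⊂ V_1 of (x_0, p_0), and a unique analytic function φ: (−ε, ε) → ℂ^n such that (φ, φ̇) maps (−ε, ε) into 𝒰, φ(0) = x_0, and f_i(φ(t), φ̇(t)) = 0 for every i = 1,…,n and every t ∈ (−ε, ε). -/
set_option synthInstance.maxHeartbeats 1000000
set_option maxHeartbeats 4000000

noncomputable section

namespace DAE

open MvPolynomial

/-- The ring of differential polynomials `K{X_1,…,X_n}`: the polynomial ring in the
variables `X_j^{(l)}`, `1 ≤ j ≤ n`, `l ∈ ℕ`. -/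
abbrev DP (K : Type) [Field K] (n : ℕ) : Type := MvPolynomial (Fin n × ℕ) K

variable {K : Type} [Field K] {n : ℕ}

/-- `δ : K → K` is a derivation of the field `K`. -/
structure IsDeriv (K : Type) [Field K] (δ : K → K) : Prop where
  map_add : ∀ a b, δ (a + b) = δ a + δ b
  leibniz : ∀ a b, δ (a * b) = a * δ b + b * δ a

/-- `D` is the total derivation of `K{X}` extending the derivation `δ` of `K`, with
`D X_j^{(l)} = X_j^{(l+1)}`. The `p`-th total derivative of `g` is `D^[p] g`. -/
structure IsTotalDeriv (K : Type) [Field K] (n : ℕ) (δ : K → K) (D : DP K n → DP K n) : Prop where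
  map_add : ∀ f g, D (f + g) = D f + D g
  leibniz : ∀ f g, D (f * g) = f * D g + g * D f
  map_C : ∀ a : K, D (C a) = C (δ a)
  map_X : ∀ (j : Fin n) (l : ℕ), D (X (j, l)) = X (j, l + 1)

/-- the maximal order of derivation of `X_j` appearing in `f` (`0` when absent) -/
def ordIn (f : DP K n) (j : Fin n) : ℕ :=
  (f.vars.filter fun v => v.1 = j).sup fun v => v.2

/-- some derivative of `X_j` appears in `f` -/
def appearsIn (f : DP K n) (j : Fin n) : Prop :=
  (f.vars.filter fun v => v.1 = j).Nonempty

instance {K : Type} [Field K] {n : ℕ} (f : DP K n) (j : Fin n) : Decidable (appearsIn f j) := by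
  unfold appearsIn; infer_instance

/-- the order of `f`: maximal order of derivation of a variable appearing in `f` -/
def ordOf (f : DP K n) : ℕ := f.vars.sup fun v => v.2

/-- `I` is a differential ideal (stable under the total derivation `D`) -/
def IsDiffIdeal (D : DP K n → DP K n) (I : Ideal (DP K n)) : Prop := ∀ g ∈ I, D g ∈ I

/-- the differential ideal `[f_1,…,f_r]` generated by `f_1,…,f_r` -/
def diffIdealGen (D : DP K n → DP K n) {r : ℕ} (f : Fin r → DP K n) : Ideal (DP K n) :=
  sInf {I | (∀ t, f t ∈ I) ∧ IsDiffIdeal D I}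

/-- `𝔓` is a prime differential ideal, minimal among those containing `f_1,…,f_r` -/
def IsMinimalPrimeDiff (D : DP K n → DP K n) {r : ℕ} (f : Fin r → DP K n)
    (𝔓 : Ideal (DP K n)) : Prop :=
  𝔓.IsPrime ∧ IsDiffIdeal D 𝔓 ∧ (∀ t, f t ∈ 𝔓) ∧
    ∀ Q : Ideal (DP K n), Q.IsPrime → IsDiffIdeal D Q → (∀ t, f t ∈ Q) → Q ≤ 𝔓 → Q = 𝔓

/-- the polynomial ring `A_i := K[X^{[i]}]` -/
abbrev AP (K : Type) [Field K] (n i : ℕ) : Type := MvPolynomial (Fin n × Fin (i + 1)) K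

/-- the inclusion `A_i ↪ K{X}` -/
def inclA (K : Type) [Field K] (n i : ℕ) : AP K n i →+* DP K n :=
  (rename fun v : Fin n × Fin (i + 1) => ((v.1, (v.2 : ℕ)) : Fin n × ℕ)).toRingHom

/-- the truncation `K{X} → A_i` (a retraction of `inclA`, exact on polynomials of
order at most `i`) -/
def truncA (K : Type) [Field K] (n i : ℕ) : DP K n →+* AP K n i :=
  (aeval fun v : Fin n × ℕ =>
    if h : v.2 < i + 1 then (X (v.1, ⟨v.2, h⟩) : AP K n i) else 0).toRingHom

/-- the contraction `A_i ∩ 𝔓` -/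
def Pc {K : Type} [Field K] {n : ℕ} (i : ℕ) (𝔓 : Ideal (DP K n)) : Ideal (AP K n i) :=
  𝔓.comap (inclA K n i)

instance {K : Type} [Field K] {n : ℕ} (i : ℕ) (𝔓 : Ideal (DP K n)) [𝔓.IsPrime] :
    (Pc i 𝔓).IsPrime := Ideal.IsPrime.comap _

/-- the local ring `B_i`: the localization of `A_i` at the prime `A_i ∩ 𝔓` -/
abbrev BL (K : Type) [Field K] (n : ℕ) (i : ℕ) (𝔓 : Ideal (DP K n)) [𝔓.IsPrime] : Type :=
  Localization.AtPrime (Pc (K := K) (n := n) i 𝔓)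

/-- the transition map `A_i → A_{i'}` for `i ≤ i'` -/
def renAA (K : Type) [Field K] (n : ℕ) {i i' : ℕ} (h : i ≤ i') : AP K n i →+* AP K n i' :=
  (rename (Prod.map (id : Fin n → Fin n) (Fin.castLE (by omega)))).toRingHom

lemma inclA_comp_renAA (K : Type) [Field K] (n : ℕ) {i i' : ℕ} (h : i ≤ i') :
    (inclA K n i').comp (renAA K n h) = inclA K n i := by
  ext p
  · simp [inclA, renAA]
  · simp [inclA, renAA]

lemma Pc_eq_comap {K : Type} [Field K] {n : ℕ} (𝔓 : Ideal (DP K n)) {i i' : ℕ} (h : i ≤ i') :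
    Pc i 𝔓 = (Pc i' 𝔓).comap (renAA K n h) := by
  unfold Pc
  rw [Ideal.comap_comap, inclA_comp_renAA]

/-- the canonical local map `B_i → B_{i'}`, `i ≤ i'` -/
def ringBB {K : Type} [Field K] {n : ℕ} (𝔓 : Ideal (DP K n)) [𝔓.IsPrime] {i i' : ℕ}
    (h : i ≤ i') : BL K n i 𝔓 →+* BL K n i' 𝔓 :=
  Localization.localRingHom _ _ (renAA K n h) (Pc_eq_comap 𝔓 h)

/-- the canonical local map `B_i → K{X}_𝔓` -/
def ringBP {K : Type} [Field K] {n : ℕ} (𝔓 : Ideal (DP K n)) [𝔓.IsPrime] (i : ℕ) :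
    BL K n i 𝔓 →+* Localization.AtPrime 𝔓 :=
  Localization.localRingHom _ _ (inclA K n i) rfl

/-- the image in `B_j` of a differential polynomial (of order `≤ j`) -/
def bElem {K : Type} [Field K] {n : ℕ} (𝔓 : Ideal (DP K n)) [𝔓.IsPrime] (j : ℕ)
    (g : DP K n) : BL K n j 𝔓 :=
  algebraMap (AP K n j) (BL K n j 𝔓) (truncA K n j g)

/-- the prolongation ideal `Δ_m = (f_1^{[m-1]},…,f_r^{[m-1]})` in the ring `B_j` -/
def prolong (D : DP K n → DP K n) {r : ℕ} (f : Fin r → DP K n)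
    (𝔓 : Ideal (DP K n)) [𝔓.IsPrime] (m j : ℕ) : Ideal (BL K n j 𝔓) :=
  Ideal.span {x | ∃ (t : Fin r) (s : ℕ) (a : AP K n j),
    s < m ∧ inclA K n j a = D^[s] (f t) ∧ x = algebraMap (AP K n j) (BL K n j 𝔓) a}

/-- `Δ := 𝔓·K{X}_𝔓` -/
def bigDelta {K : Type} [Field K] {n : ℕ} (𝔓 : Ideal (DP K n)) [𝔓.IsPrime] :
    Ideal (Localization.AtPrime 𝔓) :=
  Ideal.map (algebraMap (DP K n) (Localization.AtPrime 𝔓)) 𝔓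

instance {K : Type} [Field K] {n : ℕ} (𝔓 : Ideal (DP K n)) [𝔓.IsPrime] :
    IsDomain (DP K n ⧸ 𝔓) := Ideal.Quotient.isDomain 𝔓

/-- `𝕂 := Frac(K{X}/𝔓)`, the residual field of `𝔓` -/
abbrev KK (K : Type) [Field K] (n : ℕ) (𝔓 : Ideal (DP K n)) [𝔓.IsPrime] : Type :=
  FractionRing (DP K n ⧸ 𝔓)

/-- the canonical map `K{X} → 𝕂` -/
def toKK {K : Type} [Field K] {n : ℕ} (𝔓 : Ideal (DP K n)) [𝔓.IsPrime] :
    DP K n →+* KK K n 𝔓 :=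
  (algebraMap (DP K n ⧸ 𝔓) (KK K n 𝔓)).comp (Ideal.Quotient.mk 𝔓)

/-- the Jacobian matrix of `f_1^{[i-1]},…,f_r^{[i-1]}` with respect to `X^{[i-1+e]}`,
with entries taken in `𝕂` (full row rank over the domain `A_{i-1+e}/(A_{i-1+e}∩𝔓)` is
equivalent to full rank over its fraction field, hence over `𝕂`). -/
def qrJac (D : DP K n → DP K n) {r : ℕ} (f : Fin r → DP K n)
    (𝔓 : Ideal (DP K n)) [𝔓.IsPrime] (e i : ℕ) :
    Matrix (Fin r × Fin i) (Fin n × Fin (i + e)) (KK K n 𝔓) :=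
  fun p q => toKK 𝔓 (pderiv (q.1, (q.2 : ℕ)) (D^[(p.2 : ℕ)] (f p.1)))

/-- the system `f_1,…,f_r` is quasi-regular at `𝔓` -/
def IsQuasiRegularAt (D : DP K n → DP K n) {r : ℕ} (f : Fin r → DP K n)
    (𝔓 : Ideal (DP K n)) [𝔓.IsPrime] (e : ℕ) : Prop :=
  ∀ i : ℕ, 1 ≤ i → (qrJac D f 𝔓 e i).rank = r * i

/-- the entry of the pseudo-Jacobian `𝔍_{k,i}` in block `(p,q)`, row `t := p.2`,
column `j := q.2`: `∂ f_t^{(i-e+1+p)} / ∂ X_j^{(i+1+q)}` -/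
def jEntry (D : DP K n → DP K n) {r : ℕ} (f : Fin r → DP K n) (e i : ℕ) {k : ℕ}
    (p : Fin k × Fin r) (q : Fin k × Fin n) : DP K n :=
  pderiv (q.2, i + 1 + (q.1 : ℕ)) (D^[i + 1 - e + (p.1 : ℕ)] (f p.2))

/-- the pseudo-Jacobian `𝔍_{k,i}` over `𝕂` -/
def Jmat (D : DP K n → DP K n) {r : ℕ} (f : Fin r → DP K n)
    (𝔓 : Ideal (DP K n)) [𝔓.IsPrime] (e k i : ℕ) :
    Matrix (Fin k × Fin r) (Fin k × Fin n) (KK K n 𝔓) :=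
  fun p q => toKK 𝔓 (jEntry D f e i p q)

/-- `μ_{k,i} := kr − rank_𝕂 𝔍_{k,i}` -/
def mu (D : DP K n → DP K n) {r : ℕ} (f : Fin r → DP K n)
    (𝔓 : Ideal (DP K n)) [𝔓.IsPrime] (e k i : ℕ) : ℕ :=
  k * r - (Jmat D f 𝔓 e k i).rank

/-- the pseudo-Jacobian `𝔍_{k,i}` over the ring `B_j / Δ_m` -/
def JmatOver (D : DP K n → DP K n) {r : ℕ} (f : Fin r → DP K n)
    (𝔓 : Ideal (DP K n)) [𝔓.IsPrime] (e k i m j : ℕ) :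
    Matrix (Fin k × Fin r) (Fin k × Fin n) (BL K n j 𝔓 ⧸ prolong D f 𝔓 m j) :=
  fun p q => Ideal.Quotient.mk _ (bElem 𝔓 j (jEntry D f e i p q))

/-- the standing rank hypothesis: for every `k,i` the rank of `𝔍_{k,i}` over the
domain `B_{i+k+s}/Δ_{i-1+e+k+s}` does not depend on `s` and equals its rank over `𝕂` -/
def StandingRank (D : DP K n → DP K n) {r : ℕ} (f : Fin r → DP K n)
    (𝔓 : Ideal (DP K n)) [𝔓.IsPrime] (e : ℕ) : Prop :=
  ∀ k i s : ℕ, 1 ≤ k → e - 1 ≤ i →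
    (JmatOver D f 𝔓 e k i (i - 1 + e + k + s) (i + k + s)).rank = (Jmat D f 𝔓 e k i).rank

/-- the Jacobi number of a matrix of natural numbers -/
def jacobiN {ι κ : Type} [Fintype ι] [Fintype κ] [DecidableEq ι] [DecidableEq κ]
    (M : ι → κ → ℕ) : ℕ :=
  Finset.univ.sup fun τ : {τ : ι → κ // Function.Injective τ} => ∑ i, M i (τ.1 i)

/-- the Jacobi number of a matrix with entries in `ℕ₀ ∪ {−∞}` -/
def jacobiE {ι κ : Type} [Fintype ι] [Fintype κ] [DecidableEq ι] [DecidableEq κ]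
    (M : ι → κ → WithBot ℕ) : WithBot ℕ :=
  Finset.univ.sup fun τ : {τ : ι → κ // Function.Injective τ} => ∑ i, M i (τ.1 i)

/-- the (finite) transcendence degree of `E` over `F` equals `d` -/
def HasTrdeg (F E : Type) [CommRing F] [CommRing E] [Algebra F E] (d : ℕ) : Prop :=
  ∃ s : Finset E, IsTranscendenceBasis F (fun x : {x : E // x ∈ s} => x.1) ∧ s.card = d

end DAE

namespace DAE

open MvPolynomial

/-- evaluation of a differential polynomial of order `≤ 1` at a point
`(x, p) ∈ ℂ^n × ℂ^n` (`X_j^{(0)} ↦ x_j`, `X_j^{(1)} ↦ p_j`) -/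
def ev1 {n : ℕ} (x p : Fin n → ℂ) : DP ℂ n →+* ℂ :=
  (eval fun v : Fin n × ℕ => if v.2 = 0 then x v.1 else if v.2 = 1 then p v.1 else 0)

/-- the gradient at `(x,p)` of a polynomial of `ℂ[X,Ẋ]`, w.r.t. the `2n` variables -/
def grad1 {n : ℕ} (x p : Fin n → ℂ) (g : DP ℂ n) : Fin n × Fin 2 → ℂ :=
  fun w => ev1 x p (pderiv (w.1, (w.2 : ℕ)) g)

open Metric Filter Topology Set in
lemma holODE {E : Type*} [NormedAddCommGroup E] [NormedSpace ℂ E] [CompleteSpace E]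
    (F : E → E) (y0 : E) (R : ℝ) (hR : 0 < R) (K : NNReal)
    (hd : DifferentiableOn ℂ F (ball y0 R)) (hl : LipschitzOnWith K F (ball y0 R)) :
    ∃ r : ℝ, 0 < r ∧ ∃ γ : ℂ → E, γ 0 = y0 ∧
      ∀ z ∈ ball (0:ℂ) r, γ z ∈ ball y0 R ∧ HasDerivAt γ (F (γ z)) z := by
  set C : ℝ := ‖F y0‖ + K * R + 1 with hC
  have hC0 : 0 < C := by positivity
  have hy0 : y0 ∈ ball y0 R := mem_ball_self hR
  have hFC : ∀ y ∈ ball y0 R, ‖F y‖ ≤ C := by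
    intro y hy
    have h1 := hl.dist_le_mul y hy y0 hy0
    rw [dist_eq_norm] at h1
    have h2 : ‖F y‖ ≤ ‖F y - F y0‖ + ‖F y0‖ := by
      simpa using norm_add_le (F y - F y0) (F y0)
    have h3 : (K:ℝ) * dist y y0 ≤ K * R := by
      gcongr
      exact (mem_ball.1 hy).le
    linarith
  set r : ℝ := min (R / (2 * C)) (1 / (2 * (K + 1))) with hr
  have hr0 : 0 < r := by
    apply lt_min <;> positivity
  have hrC : C * r ≤ R / 2 := by
    have : r ≤ R / (2 * C) := min_le_left _ _
    calc C * r ≤ C * (R / (2 * C)) := by gcongr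
      _ = R / 2 := by field_simp
  have hrK : K * r ≤ 1 / 2 := by
    have : r ≤ 1 / (2 * (K + 1)) := min_le_right _ _
    calc K * r ≤ (K + 1) * (1 / (2 * (K + 1))) := by
          gcongr
          linarith
      _ = 1 / 2 := by field_simp
  have h0r : (0:ℂ) ∈ ball (0:ℂ) r := mem_ball_self hr0
  let P : (ℂ → E) → Prop := fun γ => DifferentiableOn ℂ γ (ball 0 r) ∧ γ 0 = y0 ∧
    ∀ z ∈ ball (0:ℂ) r, γ z ∈ closedBall y0 (R / 2)
  have hsub : closedBall y0 (R / 2) ⊆ ball y0 R := closedBall_subset_ball (by linarith)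
  have step : ∀ γ : {γ // P γ}, ∃ γ' : {γ // P γ},
      ∀ z ∈ ball (0:ℂ) r, HasDerivAt γ'.1 (F (γ.1 z)) z := by
    rintro ⟨γ, h1, h2, h3⟩
    have hex : Complex.IsExactOn (fun z => F (γ z)) (ball 0 r) :=
      DifferentiableOn.isExactOn_ball (hd.comp h1 (fun z hz => hsub (h3 z hz)))
    obtain ⟨g, hg0, hg⟩ := hex.with_val_at 0 y0
    refine ⟨⟨g, fun z hz => (hg z hz).differentiableAt.differentiableWithinAt, hg0, ?_⟩, hg⟩
    intro z hz
    have := (convex_ball (0:ℂ) r).norm_image_sub_le_of_norm_hasDerivWithin_le (C := C)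
      (fun w hw => (hg w hw).hasDerivWithinAt) (fun w hw => hFC _ (hsub (h3 w hw))) h0r hz
    rw [mem_closedBall, dist_eq_norm, ← hg0]
    refine this.trans (le_trans ?_ hrC)
    have : ‖z‖ ≤ r := by simpa using (mem_ball.1 hz).le
    rw [sub_zero]; gcongr
  choose next hnext using step
  let u0 : {γ // P γ} := ⟨fun _ => y0, differentiableOn_const _, rfl, fun z _ =>
    mem_closedBall_self (by linarith)⟩
  let u : ℕ → {γ // P γ} := fun k => Nat.rec u0 (fun _ γ => next γ) k
  have hu : ∀ k, ∀ z ∈ ball (0:ℂ) r, HasDerivAt (u (k+1)).1 (F ((u k).1 z)) z :=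
    fun k => hnext (u k)
  have hb : ∀ k, ∀ z ∈ ball (0:ℂ) r, ‖(u (k+1)).1 z - (u k).1 z‖ ≤ R * (1/2)^k := by
    intro k
    induction k with
    | zero =>
      intro z hz
      have h1 := (u 1).2.2.2 z hz
      have h2 := (u 0).2.2.2 z hz
      rw [mem_closedBall] at h1 h2
      rw [← dist_eq_norm]
      have := dist_triangle_right ((u 1).1 z) ((u 0).1 z) y0
      simp only [zero_add, pow_zero, mul_one]
      linarith
    | succ k ih =>
      intro z hz
      have := (convex_ball (0:ℂ) r).norm_image_sub_le_of_norm_hasDerivWithin_le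
        (C := K * (R * (1/2)^k)) (f := fun w => (u (k+2)).1 w - (u (k+1)).1 w)
        (fun w hw => ((hu (k+1) w hw).sub (hu k w hw)).hasDerivWithinAt)
        (fun w hw => by
          rw [← dist_eq_norm]
          refine (hl.dist_le_mul _ (hsub ((u (k+1)).2.2.2 w hw)) _
            (hsub ((u k).2.2.2 w hw))).trans ?_
          rw [dist_eq_norm]
          gcongr
          exact ih w hw) h0r hz
      simp only [(u (k+2)).2.2.1, (u (k+1)).2.2.1, sub_self, sub_zero] at this
      refine this.trans ?_
      have hz' : ‖z‖ ≤ r := by simpa using (mem_ball.1 hz).le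
      calc K * (R * (1/2)^k) * ‖z‖ ≤ K * (R * (1/2)^k) * r := by gcongr
        _ = (K * r) * (R * (1/2)^k) := by ring
        _ ≤ (1/2) * (R * (1/2)^k) := by gcongr
        _ = _ := by ring
  have hlim : ∀ z, ∃ a, z ∈ ball (0:ℂ) r → Tendsto (fun k => (u k).1 z) atTop (𝓝 a) := by
    intro z
    by_cases hz : z ∈ ball (0:ℂ) r
    · obtain ⟨a, ha⟩ := cauchySeq_tendsto_of_complete
        (cauchySeq_of_le_geometric (1/2) R (by norm_num) (f := fun k => (u k).1 z) (fun k => by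
          rw [dist_comm, dist_eq_norm]; exact hb k z hz))
      exact ⟨a, fun _ => ha⟩
    · exact ⟨0, fun h => absurd h hz⟩
  choose γ hγ using hlim
  have hunif : TendstoUniformlyOn (fun k => (u k).1) γ atTop (ball 0 r) := by
    rw [Metric.tendstoUniformlyOn_iff]
    intro ε hε
    have ht : Tendsto (fun k : ℕ => R * (1/2:ℝ)^k / (1 - 1/2)) atTop (𝓝 0) := by
      have := ((tendsto_pow_atTop_nhds_zero_of_lt_one (r := (1/2:ℝ)) (by norm_num)
        (by norm_num)).const_mul R).div_const (1 - 1/2)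
      simpa using this
    filter_upwards [ht.eventually_lt_const hε] with k hk z hz
    rw [dist_comm]
    refine lt_of_le_of_lt ?_ hk
    exact dist_le_of_le_geometric_of_tendsto (1/2) R (by norm_num) (f := fun k => (u k).1 z)
      (fun k => by rw [dist_comm, dist_eq_norm]; exact hb k z hz) (hγ z hz) k
  have hloc := hunif.tendstoLocallyUniformlyOn
  have hdiff : DifferentiableOn ℂ γ (ball 0 r) :=
    hloc.differentiableOn (Eventually.of_forall fun k => (u k).2.1) isOpen_ball
  have hder := hloc.deriv (Eventually.of_forall fun k => (u k).2.1) isOpen_ball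
  have hmem : ∀ z ∈ ball (0:ℂ) r, γ z ∈ ball y0 R := fun z hz =>
    hsub (isClosed_closedBall.mem_of_tendsto (hγ z hz)
      (Eventually.of_forall fun k => (u k).2.2.2 z hz))
  refine ⟨r, hr0, γ, ?_, fun z hz => ⟨hmem z hz, ?_⟩⟩
  · refine tendsto_nhds_unique (hγ 0 h0r) ?_
    simp only [fun k => (u k).2.2.1]
    exact tendsto_const_nhds
  · have hda : DifferentiableAt ℂ γ z := hdiff.differentiableAt (isOpen_ball.mem_nhds hz)
    have h1 : Tendsto (fun k => deriv (u (k+1)).1 z) atTop (𝓝 (deriv γ z)) :=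
      ((hder.tendsto_at hz).comp (tendsto_add_atTop_nat 1))
    have h2 : Tendsto (fun k => deriv (u (k+1)).1 z) atTop (𝓝 (F (γ z))) := by
      simp only [fun k => (hu k z hz).deriv]
      exact ((hl.continuousOn.continuousAt (isOpen_ball.mem_nhds (hmem z hz))).tendsto).comp
        (hγ z hz)
    rw [← tendsto_nhds_unique h1 h2]
    exact hda.hasDerivAt

open Metric Filter Topology Set in
lemma vanish_aux {ι : Type*} (S : Set ι) (H : ι → ℂ → ℂ) (c : ℂ → ℂ) (r : ℝ) (hr : 0 < r)
    (hH : ∀ h ∈ S, AnalyticOnNhd ℂ (H h) (ball 0 r)) (hc : AnalyticOnNhd ℂ c (ball 0 r))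
    (h0 : ∀ h ∈ S, H h 0 = 0)
    (hder : ∀ h ∈ S, ∃ h' ∈ S, ∀ z ∈ ball (0:ℂ) r, deriv (H h) z = c z * H h' z) :
    ∀ h ∈ S, ∀ z ∈ ball (0:ℂ) r, H h z = 0 := by
  have h0r : (0:ℂ) ∈ ball (0:ℂ) r := mem_ball_self hr
  have key : ∀ k : ℕ, ∀ h ∈ S, (k : ℕ∞) ≤ analyticOrderAt (H h) 0 := by
    intro k
    induction k with
    | zero => intro h _; simp
    | succ k ih =>
      intro h hh
      obtain ⟨h', hh', hd⟩ := hder h hh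
      push_cast
      rw [← analyticOrderAt_deriv_ge_iff (hH h hh 0 h0r) (h0 h hh)]
      have he : deriv (H h) =ᶠ[𝓝 0] c * H h' := by
        filter_upwards [isOpen_ball.mem_nhds h0r] with z hz
        exact hd z hz
      rw [analyticOrderAt_congr he, analyticOrderAt_mul (hc 0 h0r) (hH h' hh' 0 h0r)]
      exact (ih h' hh').trans le_add_self
  intro h hh
  have htop : analyticOrderAt (H h) 0 = ⊤ := by
    by_contra hne
    obtain ⟨m, hm⟩ := ENat.ne_top_iff_exists.1 hne
    have := key (m+1) h hh
    rw [← hm] at this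
    norm_cast at this
    omega
  exact (hH h hh).eqOn_zero_of_preconnected_of_eventuallyEq_zero
    (convex_ball (0:ℂ) r).isPreconnected h0r (analyticOrderAt_eq_top.1 htop)

/-- polynomials of order at most one -/
def S1 (n : ℕ) : Subalgebra ℂ (DP ℂ n) := supported ℂ {v : Fin n × ℕ | v.2 ≤ 1}

lemma mem_S1 {n : ℕ} (g : DP ℂ n) : ordOf g ≤ 1 ↔ g ∈ S1 n := by
  unfold S1
  rw [mem_supported, ordOf, Finset.sup_le_iff]
  rfl

lemma X_mem_S1 {n : ℕ} (j : Fin n) (l : ℕ) (hl : l ≤ 1) : (X (j, l) : DP ℂ n) ∈ S1 n :=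
  X_mem_supported.2 hl

lemma pderiv_mem_S1 {n : ℕ} (v : Fin n × ℕ) (g : DP ℂ n) (hg : g ∈ S1 n) :
    pderiv v g ∈ S1 n := by
  unfold S1 at hg
  rw [supported_eq_adjoin_X] at hg
  induction hg using Algebra.adjoin_induction with
  | mem x hx =>
    obtain ⟨w, hw, rfl⟩ := hx
    by_cases h : w = v
    · subst h; rw [pderiv_X_self]; exact one_mem _
    · rw [pderiv_X_of_ne h]; exact zero_mem _
  | algebraMap r =>
    rw [MvPolynomial.algebraMap_eq, pderiv_C]; exact zero_mem _
  | add x y hx hy h1 h2 => rw [map_add]; exact add_mem h1 h2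
  | mul x y hx hy h1 h2 =>
    rw [pderiv_mul]
    exact add_mem (mul_mem h1 hy) (mul_mem hx h2)

lemma D_formula {n : ℕ} (D : DP ℂ n → DP ℂ n) (hD : IsTotalDeriv ℂ n (fun _ => 0) D)
    (g : DP ℂ n) (hg : g ∈ S1 n) :
    D g = ∑ j, X (j, 1) * pderiv (j, 0) g + ∑ j, X (j, 2) * pderiv (j, 1) g := by
  let D' : Derivation ℂ (DP ℂ n) (DP ℂ n) := Derivation.mk'
    { toFun := D
      map_add' := hD.map_add
      map_smul' := by
        intro a f
        rw [MvPolynomial.smul_eq_C_mul, hD.leibniz, hD.map_C]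
        simp [MvPolynomial.smul_eq_C_mul] }
    (by intro a b; exact hD.leibniz a b)
  let D2 : Derivation ℂ (DP ℂ n) (DP ℂ n) :=
    ∑ j, (X (j, 1) : DP ℂ n) • pderiv (j, 0) + ∑ j, (X (j, 2) : DP ℂ n) • pderiv (j, 1)
  have h2 : ∀ f, D2 f = ∑ j, X (j, 1) * pderiv (j, 0) f + ∑ j, X (j, 2) * pderiv (j, 1) f := by
    intro f
    have hs : ∀ (T : Finset (Fin n)) (G : Fin n → Derivation ℂ (DP ℂ n) (DP ℂ n)),
        (∑ j ∈ T, G j) f = ∑ j ∈ T, G j f := by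
      intro T G
      induction T using Finset.induction_on with
      | empty => simp
      | insert a T ha ih => rw [Finset.sum_insert ha, Finset.sum_insert ha, Derivation.add_apply, ih]
    simp only [D2, Derivation.add_apply, hs, Derivation.smul_apply, smul_eq_mul]
  have : D' g = D2 g := by
    refine derivation_eqOn_supported (s := {v : Fin n × ℕ | v.2 ≤ 1}) ?_ hg
    rintro ⟨i, l⟩ hl
    have hl' : l ≤ 1 := hl
    change D (X (i, l)) = D2 (X (i, l))
    rw [hD.map_X, h2]
    interval_cases l
    · simp [pderiv_X, Pi.single_apply]
    · simp [pderiv_X, Pi.single_apply]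
  rw [← h2, ← this]; rfl

lemma ev1_C {n : ℕ} (x p : Fin n → ℂ) (a : ℂ) : ev1 x p (C a) = a := by simp [ev1]

lemma ev1_X0 {n : ℕ} (x p : Fin n → ℂ) (j : Fin n) : ev1 x p (X (j, 0)) = x j := by simp [ev1]

lemma ev1_X1 {n : ℕ} (x p : Fin n → ℂ) (j : Fin n) : ev1 x p (X (j, 1)) = p j := by simp [ev1]

lemma ev1_X2 {n : ℕ} (x p : Fin n → ℂ) (j : Fin n) (l : ℕ) : ev1 x p (X (j, l+2)) = 0 := by
  simp [ev1]

lemma ev1_contDiff {n : ℕ} (g : DP ℂ n) :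
    ContDiff ℂ 1 (fun y : (Fin n → ℂ) × (Fin n → ℂ) => ev1 y.1 y.2 g) := by
  induction g using MvPolynomial.induction_on with
  | C a => simp only [ev1_C]; exact contDiff_const
  | add p q hp hq => simp only [map_add]; exact hp.add hq
  | mul_X p v hp =>
    obtain ⟨j, l⟩ := v
    simp only [map_mul]
    refine hp.mul ?_
    match l with
    | 0 => simp only [ev1_X0]; fun_prop
    | 1 => simp only [ev1_X1]; fun_prop
    | l+2 => simp only [ev1_X2]; fun_prop

/-- the differential of the evaluation -/
def dEv {n : ℕ} (y : (Fin n → ℂ) × (Fin n → ℂ)) (g : DP ℂ n) :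
    ((Fin n → ℂ) × (Fin n → ℂ)) →L[ℂ] ℂ :=
  ∑ j, ev1 y.1 y.2 (pderiv (j, 0) g) •
    ((ContinuousLinearMap.proj j).comp (ContinuousLinearMap.fst ℂ (Fin n → ℂ) (Fin n → ℂ))) +
  ∑ j, ev1 y.1 y.2 (pderiv (j, 1) g) •
    ((ContinuousLinearMap.proj j).comp (ContinuousLinearMap.snd ℂ (Fin n → ℂ) (Fin n → ℂ)))

lemma dEv_apply {n : ℕ} (y v : (Fin n → ℂ) × (Fin n → ℂ)) (g : DP ℂ n) :
    dEv y g v = ∑ j, ev1 y.1 y.2 (pderiv (j, 0) g) * v.1 j +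
      ∑ j, ev1 y.1 y.2 (pderiv (j, 1) g) * v.2 j := by
  simp [dEv]

lemma ev1_hasStrictFDerivAt {n : ℕ} (g : DP ℂ n) (y : (Fin n → ℂ) × (Fin n → ℂ)) :
    HasStrictFDerivAt (fun y : (Fin n → ℂ) × (Fin n → ℂ) => ev1 y.1 y.2 g) (dEv y g) y := by
  induction g using MvPolynomial.induction_on with
  | C a =>
    simp only [ev1_C]
    have : dEv y (C a) = 0 := by
      ext v <;> simp [dEv]
    rw [this]; exact hasStrictFDerivAt_const _ _
  | add p q hp hq =>
    simp only [map_add]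
    have : dEv y (p + q) = dEv y p + dEv y q := by
      refine ContinuousLinearMap.ext fun v => ?_
      simp only [dEv_apply, map_add, add_mul, Finset.sum_add_distrib, add_apply]
      ring
    rw [this]; exact hp.add hq
  | mul_X p v hp =>
    obtain ⟨j, l⟩ := v
    simp only [map_mul]
    have hX : HasStrictFDerivAt (fun y : (Fin n → ℂ) × (Fin n → ℂ) => ev1 y.1 y.2 (X (j, l)))
        (dEv y (X (j, l))) y := by
      match l with
      | 0 =>
        simp only [ev1_X0]
        have : dEv y (X (j, 0)) = ((ContinuousLinearMap.proj j).comp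
          (ContinuousLinearMap.fst ℂ (Fin n → ℂ) (Fin n → ℂ))) := by
          refine ContinuousLinearMap.ext fun v => ?_
          simp [dEv_apply, pderiv_X, Pi.single_apply, apply_ite (ev1 y.1 y.2)]
        rw [this]
        exact ((ContinuousLinearMap.proj (R := ℂ) (φ := fun _ : Fin n => ℂ) j).comp
          (ContinuousLinearMap.fst ℂ (Fin n → ℂ) (Fin n → ℂ))).hasStrictFDerivAt
      | 1 =>
        simp only [ev1_X1]
        have : dEv y (X (j, 1)) = ((ContinuousLinearMap.proj j).comp
          (ContinuousLinearMap.snd ℂ (Fin n → ℂ) (Fin n → ℂ))) := by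
          refine ContinuousLinearMap.ext fun v => ?_
          simp [dEv_apply, pderiv_X, Pi.single_apply, apply_ite (ev1 y.1 y.2)]
        rw [this]
        exact ((ContinuousLinearMap.proj (R := ℂ) (φ := fun _ : Fin n => ℂ) j).comp
          (ContinuousLinearMap.snd ℂ (Fin n → ℂ) (Fin n → ℂ))).hasStrictFDerivAt
      | l+2 =>
        simp only [ev1_X2]
        have : dEv y (X (j, l+2)) = 0 := by
          refine ContinuousLinearMap.ext fun v => ?_
          simp [dEv_apply, pderiv_X, Pi.single_apply]
        rw [this]; exact hasStrictFDerivAt_const _ _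
    convert! hp.mul hX using 1
    refine ContinuousLinearMap.ext fun v => ?_
    simp only [dEv_apply, pderiv_mul, map_add, map_mul, add_apply,
      smul_apply, smul_eq_mul, add_mul, Finset.sum_add_distrib, mul_add,
      Finset.mul_sum]
    have e : ∀ a b c : ℂ, a * b * c = b * (a * c) := fun a b c => by ring
    simp only [e _ (ev1 y.1 y.2 (X (j, l))), mul_assoc]
    ring

lemma exists_gens {n : ℕ} (𝔔 : Ideal (DP ℂ n)) (x0 p0 : Fin n → ℂ)
    (hunram : Module.finrank ℂ (Submodule.span ℂ
      {w : Fin n → ℂ | ∃ g ∈ 𝔔, ordOf g ≤ 1 ∧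
        w = fun j : Fin n => ev1 x0 p0 (pderiv (j, 1) g)}) = n) :
    ∃ g : Fin n → DP ℂ n, (∀ i, g i ∈ 𝔔) ∧ (∀ i, g i ∈ S1 n) ∧
      ∀ i j, ev1 x0 p0 (pderiv (j, 1) (g i)) = if i = j then 1 else 0 := by
  let N : Submodule ℂ (DP ℂ n) := (𝔔.restrictScalars ℂ) ⊓ (Subalgebra.toSubmodule (S1 n))
  let L : DP ℂ n →ₗ[ℂ] (Fin n → ℂ) :=
    { toFun := fun g j => ev1 x0 p0 (pderiv (j, 1) g)
      map_add' := by intro a b; ext j; simp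
      map_smul' := by
        intro a b; ext j
        simp [MvPolynomial.smul_eq_C_mul, ev1_C] }
  have hset : {w : Fin n → ℂ | ∃ g ∈ 𝔔, ordOf g ≤ 1 ∧
        w = fun j : Fin n => ev1 x0 p0 (pderiv (j, 1) g)} = (N.map L : Set (Fin n → ℂ)) := by
    ext w
    constructor
    · rintro ⟨g, h1, h2, rfl⟩
      exact ⟨g, ⟨h1, (mem_S1 g).1 h2⟩, rfl⟩
    · rintro ⟨g, ⟨h1, h2⟩, rfl⟩
      exact ⟨g, h1, (mem_S1 g).2 h2, rfl⟩
  rw [hset, Submodule.span_eq] at hunram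
  have htop : N.map L = ⊤ := by
    apply Submodule.eq_top_of_finrank_eq
    simpa using hunram
  have : ∀ i : Fin n, ∃ g ∈ N, L g = fun j => if i = j then 1 else 0 := by
    intro i
    have : (fun j => if i = j then 1 else 0 : Fin n → ℂ) ∈ N.map L := by rw [htop]; trivial
    simpa using this
  choose g hg hL using this
  exact ⟨g, fun i => (hg i).1, fun i => (hg i).2, fun i j => congrFun (hL i) j⟩

lemma exists_adj {n : ℕ} (M : Fin n → Fin n → DP ℂ n) (hM : ∀ i j, M i j ∈ S1 n) :
    ∃ (Δ : DP ℂ n) (A : Fin n → Fin n → DP ℂ n), Δ ∈ S1 n ∧ (∀ i j, A i j ∈ S1 n) ∧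
      Δ = Matrix.det (Matrix.of M) ∧
      ∀ j k, ∑ i, A j i * M i k = if j = k then Δ else 0 := by
  let M' : Matrix (Fin n) (Fin n) (S1 n) := fun i j => ⟨M i j, hM i j⟩
  refine ⟨(M'.det : S1 n), fun i j => (M'.adjugate i j : S1 n), SetLike.coe_mem _,
    fun i j => SetLike.coe_mem _, ?_, ?_⟩
  · have := RingHom.map_det (S1 n).val.toRingHom M'
    exact this
  · intro j k
    have := congrArg (fun N : Matrix (Fin n) (Fin n) (S1 n) => ((N j k : S1 n) : DP ℂ n))
      (Matrix.adjugate_mul M')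
    simp only [Matrix.mul_apply, Matrix.smul_apply, Matrix.one_apply, smul_eq_mul, mul_ite,
      mul_one, mul_zero] at this
    rw [AddSubmonoidClass.coe_finsetSum] at this
    simp only [MulMemClass.coe_mul] at this
    rw [this]
    split_ifs <;> rfl

lemma exists_field {n : ℕ} (D : DP ℂ n → DP ℂ n) (hD : IsTotalDeriv ℂ n (fun _ => 0) D)
    (𝔔 : Ideal (DP ℂ n)) (hdiff : ∀ g ∈ 𝔔, D g ∈ 𝔔) (x0 p0 : Fin n → ℂ)
    (g : Fin n → DP ℂ n) (hg : ∀ i, g i ∈ 𝔔) (hgS : ∀ i, g i ∈ S1 n)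
    (hge : ∀ i j, ev1 x0 p0 (pderiv (j, 1) (g i)) = if i = j then 1 else 0) :
    ∃ (Δ : DP ℂ n) (q : Fin n → DP ℂ n), ev1 x0 p0 Δ = 1 ∧
      (∀ h ∈ 𝔔, h ∈ S1 n → ∃ h' ∈ 𝔔, h' ∈ S1 n ∧ h' =
        Δ * (∑ j, X (j, 1) * pderiv (j, 0) h) + ∑ j, q j * pderiv (j, 1) h) ∧
      (∀ x p s : Fin n → ℂ, (∀ i, ∑ j, ev1 x p (pderiv (j, 0) (g i)) * p j +
        ∑ j, ev1 x p (pderiv (j, 1) (g i)) * s j = 0) →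
        ∀ j, ev1 x p Δ * s j = ev1 x p (q j)) := by
  obtain ⟨Δ, A, hΔ, hA, hdet, hAM⟩ := exists_adj (fun i j => pderiv (j, 1) (g i))
    (fun i j => pderiv_mem_S1 _ _ (hgS i))
  let b : Fin n → DP ℂ n := fun i => ∑ j, X (j, 1) * pderiv (j, 0) (g i)
  have hb : ∀ i, b i ∈ S1 n := fun i => sum_mem fun j _ =>
    mul_mem (X_mem_S1 j 1 le_rfl) (pderiv_mem_S1 _ _ (hgS i))
  refine ⟨Δ, fun j => - ∑ i, A j i * b i, ?_, ?_, ?_⟩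
  · rw [hdet, RingHom.map_det]
    have : (ev1 x0 p0).mapMatrix (Matrix.of fun i j => pderiv (j, 1) (g i)) = 1 := by
      ext i j
      simp [hge, Matrix.one_apply]
    rw [this, Matrix.det_one]
  · intro h hh hhS
    refine ⟨_, ?_, ?_, rfl⟩
    · have hX : ∀ j, Δ * X (j, 2) + ∑ i, A j i * b i = ∑ i, A j i * D (g i) := by
        intro j
        have : ∀ i, D (g i) = b i + ∑ k, X (k, 2) * pderiv (k, 1) (g i) :=
          fun i => D_formula D hD _ (hgS i)
        simp only [this, mul_add, Finset.sum_add_distrib, Finset.mul_sum]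
        rw [add_comm, Finset.sum_comm]
        congr 1
        have h2 : ∀ k, ∑ i, A j i * (X (k, 2) * pderiv (k, 1) (g i)) =
            X (k, 2) * (if j = k then Δ else 0) := by
          intro k
          rw [← hAM j k, Finset.mul_sum]
          exact Finset.sum_congr rfl fun i _ => by ring
        simp only [h2]
        simp [mul_comm]
      have e : Δ * (∑ j, X (j, 1) * pderiv (j, 0) h) +
          ∑ j, (- ∑ i, A j i * b i) * pderiv (j, 1) h =
          Δ * D h - ∑ j, (∑ i, A j i * D (g i)) * pderiv (j, 1) h := by
        rw [D_formula D hD h hhS]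
        simp only [← hX, add_mul, neg_mul, Finset.sum_neg_distrib, Finset.sum_add_distrib, mul_add,
          Finset.mul_sum, mul_assoc]
        ring
      rw [e]
      refine sub_mem (𝔔.mul_mem_left _ (hdiff h hh)) (sum_mem fun j _ => ?_)
      exact 𝔔.mul_mem_right _ (sum_mem fun i _ => 𝔔.mul_mem_left _ (hdiff _ (hg i)))
    · refine add_mem (mul_mem hΔ (sum_mem fun j _ => mul_mem (X_mem_S1 j 1 le_rfl)
        (pderiv_mem_S1 _ _ hhS))) (sum_mem fun j _ => mul_mem (neg_mem (sum_mem fun i _ =>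
        mul_mem (hA j i) (hb i))) (pderiv_mem_S1 _ _ hhS))
  · intro x p s hs j
    have hbe : ∀ i, ev1 x p (b i) = - ∑ k, ev1 x p (pderiv (k, 1) (g i)) * s k := by
      intro i
      rw [← add_eq_zero_iff_eq_neg, ← hs i]
      simp only [b, map_sum, map_mul, ev1_X1, mul_comm (p _)]
    simp only [map_neg, map_sum, map_mul, hbe, mul_neg, Finset.sum_neg_distrib, neg_neg,
      Finset.mul_sum]
    rw [Finset.sum_comm]
    have h2 : ∀ k, ∑ i, ev1 x p (A j i) * (ev1 x p (pderiv (k, 1) (g i)) * s k) =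
        (if j = k then ev1 x p Δ else 0) * s k := by
      intro k
      have := congrArg (ev1 x p) (hAM j k)
      rw [apply_ite (ev1 x p), map_zero, map_sum] at this
      rw [← this, Finset.sum_mul]
      exact Finset.sum_congr rfl fun i _ => by rw [map_mul]; ring
    simp only [h2]
    simp

/-- Existence and uniqueness of analytic solutions of a
zero-dimensional first-order quasi-regular DAE system `f_1(X,Ẋ) = ⋯ = f_n(X,Ẋ) = 0`
over `ℂ`, through any regular point `(x₀,p₀)` of the variety `V₁ = V(𝔔 ∩ ℂ[X,Ẋ])`
at which the projection `π : V₁ → V₀` is unramified.  Smoothness of `(x₀,p₀)` is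
expressed by: the span of the gradients at `(x₀,p₀)` of the elements of `𝔔 ∩ ℂ[X,Ẋ]`
has dimension `2n − dim V₁`; unramifiedness by: the span of their `Ẋ`-parts has full
dimension `n`. -/
theorem existence_uniqueness_analytic_solution
    {n : ℕ}
    (D : DP ℂ n → DP ℂ n) (hD : IsTotalDeriv ℂ n (fun _ => 0) D)
    (f : Fin n → DP ℂ n) (horder : ∀ t, ordOf (f t) ≤ 1)
    (𝔔 : Ideal (DP ℂ n)) [𝔔.IsPrime] (h𝔔 : 𝔔 = diffIdealGen D f)
    (hqr : IsQuasiRegularAt D f 𝔔 1)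
    (hsr : StandingRank D f 𝔔 1)
    (x0 p0 : Fin n → ℂ)
    (hx0 : ∀ g ∈ 𝔔, ordOf g ≤ 1 → ev1 x0 p0 g = 0)
    (hreg : (ringKrullDim (AP ℂ n 1 ⧸ Pc 1 𝔔) : WithBot (WithTop ℕ)) =
      ((2 * n - Module.finrank ℂ (Submodule.span ℂ
        {w : Fin n × Fin 2 → ℂ | ∃ g ∈ 𝔔, ordOf g ≤ 1 ∧ w = grad1 x0 p0 g}) : ℕ) :
          WithBot (WithTop ℕ)))
    (hunram : Module.finrank ℂ (Submodule.span ℂ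
      {w : Fin n → ℂ | ∃ g ∈ 𝔔, ordOf g ≤ 1 ∧
        w = fun j : Fin n => ev1 x0 p0 (pderiv (j, 1) g)}) = n) :
    ∃ ε : ℝ, 0 < ε ∧
    ∃ W : Set ((Fin n → ℂ) × (Fin n → ℂ)), IsOpen W ∧ (x0, p0) ∈ W ∧
    ∃ φ : ℝ → (Fin n → ℂ),
      AnalyticOnNhd ℝ φ (Set.Ioo (-ε) ε) ∧
      φ 0 = x0 ∧
      (∀ t ∈ Set.Ioo (-ε) ε, (φ t, deriv φ t) ∈ W ∧
        ∀ g ∈ 𝔔, ordOf g ≤ 1 → ev1 (φ t) (deriv φ t) g = 0) ∧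
      (∀ t ∈ Set.Ioo (-ε) ε, ∀ i : Fin n, ev1 (φ t) (deriv φ t) (f i) = 0) ∧
      ∀ ψ : ℝ → (Fin n → ℂ),
        AnalyticOnNhd ℝ ψ (Set.Ioo (-ε) ε) →
        ψ 0 = x0 →
        (∀ t ∈ Set.Ioo (-ε) ε, (ψ t, deriv ψ t) ∈ W ∧
          ∀ g ∈ 𝔔, ordOf g ≤ 1 → ev1 (ψ t) (deriv ψ t) g = 0) →
        (∀ t ∈ Set.Ioo (-ε) ε, ∀ i : Fin n, ev1 (ψ t) (deriv ψ t) (f i) = 0) →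
        ∀ t ∈ Set.Ioo (-ε) ε, ψ t = φ t := by
  classical
  have hfQ : ∀ t, f t ∈ 𝔔 := by
    intro t; rw [h𝔔]
    exact Submodule.mem_sInf.2 fun I hI => hI.1 t
  have hdiff : ∀ g ∈ 𝔔, D g ∈ 𝔔 := by
    intro g hg
    rw [h𝔔] at hg ⊢
    exact Submodule.mem_sInf.2 fun I hI => hI.2 g (Submodule.mem_sInf.1 hg I hI)
  obtain ⟨g, hg, hgS, hge⟩ := exists_gens 𝔔 x0 p0 hunram
  obtain ⟨Δ, q, hΔ, hw, hs⟩ := exists_field D hD 𝔔 hdiff x0 p0 g hg hgS hge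
  let E := (Fin n → ℂ) × (Fin n → ℂ)
  let F : E → E := fun y => (y.2, fun j => ev1 y.1 y.2 (q j) / ev1 y.1 y.2 Δ)
  let U : Set E := {y | ev1 y.1 y.2 Δ ≠ 0}
  have hU : IsOpen U := isOpen_ne_fun (ev1_contDiff Δ).continuous continuous_const
  have h0U : (x0, p0) ∈ U := by
    change ev1 x0 p0 Δ ≠ 0
    rw [hΔ]; exact one_ne_zero
  have hFc : ∀ y ∈ U, ContDiffAt ℂ 1 F y := by
    intro y hy
    refine contDiffAt_snd.prodMk (contDiffAt_pi.2 fun j => ?_)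
    exact (ev1_contDiff (q j)).contDiffAt.div (ev1_contDiff Δ).contDiffAt hy
  obtain ⟨K, s, hs0, hK⟩ :=
    ((hFc _ h0U).hasStrictFDerivAt one_ne_zero).exists_lipschitzOnWith
  -- local injectivity in the derivative variables
  have hinj : ∃ N : Set (Fin n → ℂ), IsOpen N ∧ p0 ∈ N ∧
      Set.InjOn (fun p i => ev1 x0 p (g i)) N := by
    have hst : HasStrictFDerivAt (fun p (i : Fin n) => ev1 x0 p (g i))
        ((ContinuousLinearEquiv.refl ℂ (Fin n → ℂ) : (Fin n → ℂ) →L[ℂ] (Fin n → ℂ))) p0 := by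
      rw [hasStrictFDerivAt_pi']
      intro i
      have h1 := (ev1_hasStrictFDerivAt (g i) (x0, p0)).comp p0
        ((hasStrictFDerivAt_const (𝕜 := ℂ) x0 p0).prodMk (hasStrictFDerivAt_id (𝕜 := ℂ) p0))
      convert! h1 using 1
      refine ContinuousLinearMap.ext fun v => ?_
      simp [dEv_apply, hge]
    exact ⟨(hst.toOpenPartialHomeomorph _).source, (hst.toOpenPartialHomeomorph _).open_source,
      hst.mem_toOpenPartialHomeomorph_source, (hst.toOpenPartialHomeomorph _).injOn⟩
  obtain ⟨N, hN, hp0N, hNinj⟩ := hinj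
  obtain ⟨R, hR, hRs⟩ := Metric.mem_nhds_iff.1 (Filter.inter_mem hs0 (hU.mem_nhds h0U))
  have hRK : LipschitzOnWith K F (Metric.ball (x0, p0) R) := hK.mono fun y hy => (hRs hy).1
  have hRU : ∀ y ∈ Metric.ball ((x0, p0) : E) R, ev1 y.1 y.2 Δ ≠ 0 := fun y hy => (hRs hy).2
  obtain ⟨r, hr, γ, hγ0, hγ⟩ := holODE F (x0, p0) R hR K
    (fun y hy => ((hFc y (hRs hy).2).differentiableAt one_ne_zero).differentiableWithinAt) hRK
  have hγan : AnalyticOnNhd ℂ γ (Metric.ball 0 r) :=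
    DifferentiableOn.analyticOnNhd
      (fun z hz => (hγ z hz).2.differentiableAt.differentiableWithinAt) Metric.isOpen_ball
  have hHder : ∀ h : DP ℂ n, ∀ z ∈ Metric.ball (0:ℂ) r,
      HasDerivAt (fun z => ev1 (γ z).1 (γ z).2 h) (dEv (γ z) h (F (γ z))) z := fun h z hz =>
    (ev1_hasStrictFDerivAt h (γ z)).hasFDerivAt.comp_hasDerivAt z (hγ z hz).2
  have hHan : ∀ h : DP ℂ n, AnalyticOnNhd ℂ (fun z => ev1 (γ z).1 (γ z).2 h)
      (Metric.ball 0 r) := fun h => DifferentiableOn.analyticOnNhd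
      (fun z hz => (hHder h z hz).differentiableAt.differentiableWithinAt) Metric.isOpen_ball
  have hvan : ∀ h ∈ {h : DP ℂ n | h ∈ 𝔔 ∧ h ∈ S1 n}, ∀ z ∈ Metric.ball (0:ℂ) r,
      ev1 (γ z).1 (γ z).2 h = 0 := by
    refine vanish_aux _ (fun h z => ev1 (γ z).1 (γ z).2 h)
      (fun z => (ev1 (γ z).1 (γ z).2 Δ)⁻¹) r hr (fun h _ => hHan h)
      (fun z hz => (hHan Δ z hz).inv (hRU _ (hγ z hz).1)) ?_ ?_
    · rintro h ⟨h1, h2⟩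
      simp only [hγ0]
      exact hx0 h h1 ((mem_S1 h).2 h2)
    · rintro h ⟨h1, h2⟩
      obtain ⟨h', h1', h2', he⟩ := hw h h1 h2
      refine ⟨h', ⟨h1', h2'⟩, fun z hz => ?_⟩
      rw [(hHder h z hz).deriv, dEv_apply, he]
      have hne := hRU _ (hγ z hz).1
      simp only [map_add, map_mul, map_sum, ev1_X1, F]
      rw [mul_add, inv_mul_cancel_left₀ hne, Finset.mul_sum]
      congr 1
      · exact Finset.sum_congr rfl fun j _ => mul_comm _ _
      · exact Finset.sum_congr rfl fun j _ => by rw [div_eq_mul_inv]; ring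
  -- the neighbourhood
  let W : Set E := Metric.ball (x0, p0) R ∩ {y | y.2 ∈ N}
  have hW : IsOpen W := Metric.isOpen_ball.inter (hN.preimage continuous_snd)
  have h0W : ((x0, p0) : E) ∈ W := ⟨Metric.mem_ball_self hR, hp0N⟩
  have h0r : (0:ℂ) ∈ Metric.ball (0:ℂ) r := Metric.mem_ball_self hr
  have hpre : γ ⁻¹' W ∈ nhds (0:ℂ) := by
    refine (hγan 0 h0r).continuousAt.preimage_mem_nhds (hW.mem_nhds ?_)
    rw [hγ0]; exact h0W
  obtain ⟨ε, hε, hεs⟩ := Metric.mem_nhds_iff.1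
    (Filter.inter_mem hpre (Metric.isOpen_ball.mem_nhds h0r))
  have hcast : ∀ t ∈ Set.Ioo (-ε) ε, ((t:ℂ) ∈ Metric.ball (0:ℂ) r ∧ γ t ∈ W) := by
    intro t ht
    have : (t:ℂ) ∈ Metric.ball (0:ℂ) ε := by
      rw [mem_ball_zero_iff, Complex.norm_real]
      exact abs_lt.2 ht
    exact ⟨(hεs this).2, (hεs this).1⟩
  have hηd : ∀ t ∈ Set.Ioo (-ε) ε, HasDerivAt (fun t : ℝ => γ t) (F (γ t)) t := fun t ht =>
    by
      have h1 := (hγ t (hcast t ht).1).2.scomp t (Complex.ofRealCLM.hasDerivAt (x := t))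
      simp only [Complex.ofRealCLM_apply, Complex.ofReal_one, one_smul] at h1
      exact h1
  have hφd : ∀ t ∈ Set.Ioo (-ε) ε, HasDerivAt (fun t : ℝ => (γ t).1) (γ t).2 t := fun t ht =>
    (ContinuousLinearMap.fst ℝ (Fin n → ℂ) (Fin n → ℂ)).hasFDerivAt.comp_hasDerivAt t (hηd t ht)
  have h0ε : (0:ℝ) ∈ Set.Ioo (-ε) ε := ⟨by linarith, hε⟩
  refine ⟨ε, hε, W, hW, h0W, fun t => (γ t).1, ?_, ?_, ?_, ?_, ?_⟩
  · intro t ht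
    have h1 : AnalyticAt ℝ γ (t:ℂ) := (hγan t (hcast t ht).1).restrictScalars
    have h2 : AnalyticAt ℝ (fun t : ℝ => (t:ℂ)) t := Complex.ofRealCLM.analyticAt t
    have h3 : AnalyticAt ℝ (fun t : ℝ => γ t) t := AnalyticAt.comp (g := γ) h1 h2
    exact analyticAt_fst.comp h3
  · simp [hγ0]
  · intro t ht
    rw [(hφd t ht).deriv]
    exact ⟨(hcast t ht).2, fun h h1 h2 => hvan h ⟨h1, (mem_S1 h).1 h2⟩ t (hcast t ht).1⟩
  · intro t ht i
    rw [(hφd t ht).deriv]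
    exact hvan (f i) ⟨hfQ i, (mem_S1 _).1 (horder i)⟩ t (hcast t ht).1
  · intro ψ hψ hψ0 hψW _ t ht
    have hψd : ∀ t ∈ Set.Ioo (-ε) ε, HasDerivAt (fun t => ((ψ t, deriv ψ t) : E))
        (deriv ψ t, deriv (deriv ψ) t) t := fun t ht =>
      (hψ t ht).differentiableAt.hasDerivAt.prodMk (hψ t ht).deriv.differentiableAt.hasDerivAt
    have hF : ∀ t ∈ Set.Ioo (-ε) ε, F (ψ t, deriv ψ t) = (deriv ψ t, deriv (deriv ψ) t) := by
      intro t ht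
      refine Prod.ext rfl (funext fun j => ?_)
      have hne := hRU _ (hψW t ht).1.1
      have := hs (ψ t) (deriv ψ t) (deriv (deriv ψ) t) ?_ j
      · change ev1 (ψ t) (deriv ψ t) (q j) / ev1 (ψ t) (deriv ψ t) Δ = _
        rw [← this]
        exact mul_div_cancel_left₀ _ hne
      · intro i
        have h1 : HasDerivAt (fun t => ev1 (ψ t) (deriv ψ t) (g i))
            (dEv (ψ t, deriv ψ t) (g i) (deriv ψ t, deriv (deriv ψ) t)) t := by
          have h4 := HasFDerivAt.comp_hasDerivAt (f := fun t => ((ψ t, deriv ψ t) : E)) t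
            ((ev1_hasStrictFDerivAt (g i) (ψ t, deriv ψ t)).hasFDerivAt.restrictScalars ℝ)
            (hψd t ht)
          exact h4
        have h2 : (fun t => ev1 (ψ t) (deriv ψ t) (g i)) =ᶠ[nhds t] fun _ => 0 := by
          filter_upwards [isOpen_Ioo.mem_nhds ht] with u hu
          exact (hψW u hu).2 (g i) (hg i) ((mem_S1 _).2 (hgS i))
        have h3 := h1.unique ((hasDerivAt_const t (0:ℂ)).congr_of_eventuallyEq h2)
        rw [dEv_apply] at h3
        exact h3
    have hp : deriv ψ 0 = p0 := by
      refine hNinj (hψW 0 h0ε).1.2 hp0N (funext fun i => ?_)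
      have h1 := (hψW 0 h0ε).2 (g i) (hg i) ((mem_S1 _).2 (hgS i))
      rw [hψ0] at h1
      exact h1.trans (hx0 (g i) (hg i) ((mem_S1 _).2 (hgS i))).symm
    have := ODE_solution_unique_of_mem_Ioo (v := fun _ => F)
      (s := fun _ => Metric.ball ((x0, p0) : E) R) (K := K)
      (f := fun t => ((ψ t, deriv ψ t) : E)) (g := fun t : ℝ => γ t) (fun _ _ => hRK) h0ε
      (fun t ht => ⟨by rw [hF t ht]; exact hψd t ht, (hψW t ht).1.1⟩)
      (fun t ht => ⟨hηd t ht, (hcast t ht).2.1⟩) (by simp [hψ0, hp, hγ0])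
    exact congrArg Prod.fst (this ht)

end DAE
end
end
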